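/- arXiv:2512.18900 — 2 statements merged into one kernel-verified Lean document; each statement's English description precedes it below -/
import Mathlib

section
/- Let Φ : M_d(ℂ) → M_d(ℂ) be a unital positive linear map and let X ∈ M_d(ℂ) be normal, i.e., XᴴX = XXᴴ. Then Φ(XᴴX) − Φ(Xᴴ)Φ(X) is positive semidefinite. -/
open Matrix
open scoped ComplexOrder

section SpectralResolution

open scoped Matrix.Norms.L2Operator

/-- A normal matrix admits a finite spectral resolution by positive semidefinite matrices. -/
theorem Matrix.exists_spectral_resolution {d : ℕ} (X : Matrix (Fin d) (Fin d) ℂ)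
    (hX : Xᴴ * X = X * Xᴴ) :
    ∃ (s : Finset ℂ) (P : ℂ → Matrix (Fin d) (Fin d) ℂ),
      (∀ z, (P z).PosSemidef) ∧ 1 = ∑ z ∈ s, P z ∧ X = ∑ z ∈ s, z • P z ∧
      Xᴴ = ∑ z ∈ s, star z • P z ∧ Xᴴ * X = ∑ z ∈ s, (star z * z) • P z := by
  have hn : IsStarNormal X := ⟨hX⟩
  have hfin : (spectrum ℂ X).Finite := Matrix.finite_spectrum X
  have hc (f : ℂ → ℂ) : ContinuousOn f (spectrum ℂ X) := hfin.continuousOn f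
  let P : ℂ → Matrix (Fin d) (Fin d) ℂ := fun z => cfc (fun w => if w = z then (1 : ℂ) else 0) X
  have key (f : ℂ → ℂ) : cfc f X = ∑ z ∈ hfin.toFinset, f z • P z := by
    have h1 : cfc f X =
        cfc (∑ z ∈ hfin.toFinset, fun w => f z • (if w = z then (1 : ℂ) else 0)) X := by
      refine cfc_congr fun w hw => ?_
      have hw' : w ∈ hfin.toFinset := hfin.mem_toFinset.mpr hw
      simp only [Finset.sum_apply, smul_eq_mul, mul_ite, mul_one, mul_zero, Finset.sum_ite_eq,
        if_pos hw']
    rw [h1, cfc_sum (hf := fun i _ => hc _)]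
    exact Finset.sum_congr rfl fun z _ => cfc_smul _ _ _ (hc _)
  refine ⟨hfin.toFinset, P, fun z => ?_, ?_, ?_, ?_, ?_⟩
  · have h : P z = (P z)ᴴ * P z := by
      rw [← star_eq_conjTranspose, ← cfc_star, ← cfc_mul _ _ _ (hc _) (hc _)]
      refine cfc_congr fun w _ => ?_
      by_cases hw : w = z <;> simp [hw]
    rw [h]
    exact posSemidef_conjTranspose_mul_self _
  · rw [← cfc_const_one ℂ X, key]
    simp
  · conv_lhs => rw [← cfc_id' ℂ X, key]
  · rw [← star_eq_conjTranspose, ← cfc_star_id (R := ℂ) X, key]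
  · rw [← key, cfc_mul _ _ _ (hc _) (hc _), cfc_star_id X, cfc_id' ℂ X, star_eq_conjTranspose]

end SpectralResolution

/-- A unital positive linear map `Φ : M_d(ℂ) → M_d(ℂ)` satisfies the
Kadison–Schwarz inequality on every normal matrix `X` (i.e. `XᴴX = XXᴴ`). -/
theorem kadisonSchwarz_of_normal (d : ℕ)
    (Φ : Matrix (Fin d) (Fin d) ℂ →ₗ[ℂ] Matrix (Fin d) (Fin d) ℂ)
    (hpos : ∀ A : Matrix (Fin d) (Fin d) ℂ, A.PosSemidef → (Φ A).PosSemidef)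
    (hunital : Φ 1 = 1)
    (X : Matrix (Fin d) (Fin d) ℂ) (hX : Xᴴ * X = X * Xᴴ) :
    (Φ (Xᴴ * X) - Φ Xᴴ * Φ X).PosSemidef := by
  obtain ⟨s, P, hP, h1, hid, hstar, hmul⟩ := X.exists_spectral_resolution hX
  have hQ z : (Φ (P z)).PosSemidef := hpos _ (hP z)
  have e1 : ∑ z ∈ s, Φ (P z) = 1 := by rw [← map_sum, ← h1, hunital]
  have e2 : ∑ z ∈ s, z • Φ (P z) = Φ X := by
    conv_rhs => rw [hid]
    simp
  have e3 : ∑ z ∈ s, star z • Φ (P z) = Φ Xᴴ := by rw [hstar]; simp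
  have e4 : ∑ z ∈ s, (star z * z) • Φ (P z) = Φ (Xᴴ * X) := by rw [hmul]; simp
  have e5 : (Φ X)ᴴ = Φ Xᴴ := by
    rw [← e2, ← e3, conjTranspose_sum]
    exact Finset.sum_congr rfl fun z _ => by rw [conjTranspose_smul, (hQ z).1.eq]
  have e6 : Φ (Xᴴ * X) - Φ Xᴴ * Φ X =
      ∑ z ∈ s, (z • 1 - Φ X)ᴴ * Φ (P z) * (z • 1 - Φ X) := by
    have h z : (z • 1 - Φ X)ᴴ * Φ (P z) * (z • 1 - Φ X) =
        (star z * z) • Φ (P z) - (star z • Φ (P z)) * Φ X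
          - Φ Xᴴ * (z • Φ (P z)) + Φ Xᴴ * Φ (P z) * Φ X := by
      simp only [conjTranspose_sub, conjTranspose_smul, conjTranspose_one, e5, sub_mul, mul_sub,
        smul_mul_assoc, mul_smul_comm, one_mul, mul_one, mul_smul, smul_sub, smul_comm z (star z)]
      abel
    simp only [h, Finset.sum_add_distrib, Finset.sum_sub_distrib, ← Finset.sum_mul,
      ← Finset.mul_sum, e1, e2, e3, e4, mul_one]
    abel
  rw [e6]
  exact posSemidef_sum s fun z _ => (hQ z).conjTranspose_mul_mul_same _
end

section
/- Let Φ : M_d(ℂ) → M_d(ℂ) be a unital positive linear map. Then for every Hermitian matrix A ∈ M_d(ℂ), the matrix Φ(A²) − Φ(A)² is positive semidefinite. -/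
open Matrix
open scoped ComplexOrder

/-- If positive semidefinite matrices `Q i` sum to the identity, then for real weights `c i`
the second moment `∑ i, c i ^ 2 • Q i` dominates the square of the mean `∑ i, c i • Q i`. -/
theorem posSemidef_sum_sq_smul_sub_sum_smul_sq {n ι : Type*} [Fintype n] [DecidableEq n]
    [Fintype ι] (Q : ι → Matrix n n ℂ) (hQ : ∀ i, (Q i).PosSemidef) (hsum : ∑ i, Q i = 1)
    (c : ι → ℝ) :
    ((∑ i, ((c i : ℂ) * c i) • Q i) -
      (∑ i, (c i : ℂ) • Q i) * (∑ i, (c i : ℂ) • Q i)).PosSemidef := by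
  set B := ∑ i, (c i : ℂ) • Q i with hB
  have hBH : Bᴴ = B := by
    simp [hB, conjTranspose_sum, conjTranspose_smul, (hQ _).isHermitian.eq]
  have key : (∑ i, ((c i : ℂ) * c i) • Q i) - B * B =
      ∑ i, ((c i : ℂ) • 1 - B) * Q i * ((c i : ℂ) • 1 - B)ᴴ := by
    have expand (i : ι) : ((c i : ℂ) • 1 - B) * Q i * ((c i : ℂ) • 1 - B)ᴴ =
        ((c i : ℂ) * c i) • Q i - ((c i : ℂ) • Q i) * B - B * ((c i : ℂ) • Q i)
          + B * Q i * B := by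
      simp only [conjTranspose_sub, conjTranspose_smul, conjTranspose_one, hBH,
        Complex.star_def, Complex.conj_ofReal, sub_mul, mul_sub, smul_mul_assoc, one_mul,
        mul_smul_comm, mul_one, smul_sub, smul_smul]
      abel
    simp only [expand, Finset.sum_add_distrib, Finset.sum_sub_distrib, ← Finset.sum_mul,
      ← Finset.mul_sum, hsum, ← hB, mul_one]
    abel
  rw [key]
  exact posSemidef_sum _ fun i _ => (hQ i).mul_mul_conjTranspose_same _

theorem mul_diagonal_mul_eq_sum_smul {n : Type*} [Fintype n] [DecidableEq n]
    (U V : Matrix n n ℂ) (f : n → ℂ) :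
    U * diagonal f * V = ∑ i, f i • (U * diagonal (Pi.single i 1) * V) := by
  have h : diagonal f = ∑ i, f i • diagonal (Pi.single i (1 : ℂ)) := by
    ext a b
    simp [Matrix.sum_apply, diagonal_apply, Pi.single_apply]
  rw [h, Finset.mul_sum, Finset.sum_mul]
  simp

/-- For a unital positive linear map `Φ : M_d(ℂ) → M_d(ℂ)` and every Hermitian
matrix `A`, the matrix `Φ(A²) − Φ(A)²` is positive semidefinite. -/
theorem kadison_inequality_hermitian (d : ℕ)
    (Φ : Matrix (Fin d) (Fin d) ℂ →ₗ[ℂ] Matrix (Fin d) (Fin d) ℂ)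
    (hpos : ∀ X : Matrix (Fin d) (Fin d) ℂ, X.PosSemidef → (Φ X).PosSemidef)
    (hunital : Φ 1 = 1)
    (A : Matrix (Fin d) (Fin d) ℂ) (hA : A.IsHermitian) :
    (Φ (A * A) - Φ A * Φ A).PosSemidef := by
  obtain ⟨U, c, hUU, hUU', hAU⟩ : ∃ (U : Matrix (Fin d) (Fin d) ℂ) (c : Fin d → ℝ),
      Uᴴ * U = 1 ∧ U * Uᴴ = 1 ∧ A = U * diagonal (fun i => (c i : ℂ)) * Uᴴ :=
    ⟨hA.eigenvectorUnitary, hA.eigenvalues, Unitary.coe_star_mul_self _,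
      Unitary.coe_mul_star_self _, hA.spectral_theorem⟩
  have hAA : A * A = U * diagonal (fun i => (c i : ℂ) * c i) * Uᴴ := by
    rw [← diagonal_mul_diagonal]
    calc A * A = U * diagonal (fun i => (c i : ℂ)) * (Uᴴ * U) *
          diagonal (fun i => (c i : ℂ)) * Uᴴ := by
            rw [hAU]
            simp only [mul_assoc]
      _ = _ := by simp only [hUU, mul_one, mul_assoc]
  have hone : ∑ i, U * diagonal (Pi.single i 1) * Uᴴ = 1 := by
    simpa [hUU'] using (mul_diagonal_mul_eq_sum_smul U Uᴴ 1).symm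
  have hP (i : Fin d) : (U * diagonal (Pi.single i 1) * Uᴴ).PosSemidef := by
    refine PosSemidef.mul_mul_conjTranspose_same (PosSemidef.diagonal ?_) U
    exact Pi.single_nonneg.mpr zero_le_one
  have main := posSemidef_sum_sq_smul_sub_sum_smul_sq
    (fun i => Φ (U * diagonal (Pi.single i 1) * Uᴴ)) (fun i => hpos _ (hP i))
    (by rw [← map_sum, hone, hunital]) c
  rw [hAA, hAU, mul_diagonal_mul_eq_sum_smul U Uᴴ fun i => (c i : ℂ) * c i,
    mul_diagonal_mul_eq_sum_smul U Uᴴ fun i => (c i : ℂ)]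
  simpa only [map_sum, map_smul] using main
end
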